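/- There exists a constant C = C(d, χ₀) such that for every D > 0, every function Φ : ℝ × ℝ^d × ℝ^d → ℂ satisfying sup_{s,x,y} |∂_x^α ∂_y^β Φ(s,x,y)| ≤ D for all multi-indices α, β with |α|, |β| ≤ 10d, every λ ≥ 1, and every (ξ, ζ, a, b) ∈ ℝ^{4d}: ∫_ℝ | ∫_{ℝ^{2d}} χ₀((x−a)/λ) χ₀((y−b)/λ) Φ(s,x,y) e(ξ·x + ζ·y + s(x·y)) dx dy | ds ≤ C·D·λ^{2d}. -/

import Mathlib

open MeasureTheory
open scoped RealInnerProductSpace ENNReal NNReal BigOperators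

noncomputable section

/-- `e(z) = e^{2πiz}`. -/
def efun (t : ℝ) : ℂ := Complex.exp (2 * (Real.pi : ℂ) * Complex.I * (t : ℂ))

/-- Product cutoff `χ₀(z) = χ₀(z¹)⋯χ₀(z^d)` on `ℝ^d`. -/
def cutoffProd (d : ℕ) (χ : ℝ → ℝ) (z : EuclideanSpace ℝ (Fin d)) : ℝ :=
  ∏ i, χ (z i)

/-- Directional derivative of a function along a vector. -/
def pderivAlong {X : Type*} [NormedAddCommGroup X] [NormedSpace ℝ X]
    (v : X) (f : X → ℂ) : X → ℂ :=
  fun z => fderiv ℝ f z v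

/-- Iterated directional (partial) derivatives along a list of directions. -/
def pderivList {X : Type*} [NormedAddCommGroup X] [NormedSpace ℝ X]
    (l : List X) (f : X → ℂ) : X → ℂ :=
  l.foldr pderivAlong f

/-- The multi-index derivative bounds `sup_{s,x,y} |∂_x^α ∂_y^β Φ(s,x,y)| ≤ D`
for all multi-indices `|α|, |β| ≤ 10d`. -/
def PhiDerivBound (d : ℕ) (D : ℝ)
    (Φ : ℝ → EuclideanSpace ℝ (Fin d) → EuclideanSpace ℝ (Fin d) → ℂ) : Prop :=
  ∀ lx ly : List (Fin d), lx.length ≤ 10 * d → ly.length ≤ 10 * d →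
    ∀ (s : ℝ) (x y : EuclideanSpace ℝ (Fin d)),
      ‖pderivList (lx.map fun i => EuclideanSpace.single i (1 : ℝ))
          (fun x' => pderivList (ly.map fun i => EuclideanSpace.single i (1 : ℝ))
            (fun y' => Φ s x' y') y) x‖ ≤ D


section PartialDerivatives

variable {X : Type*} [NormedAddCommGroup X] [NormedSpace ℝ X]

lemma contDiff_pderivAlong {m : ℕ} {f : X → ℂ} (v : X) (hf : ContDiff ℝ (m + 1 : ℕ) f) :
    ContDiff ℝ m (pderivAlong v f) :=
  (hf.fderiv_right (m := m) (by norm_cast)).clm_apply contDiff_const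

lemma contDiff_pderivList {m : ℕ} {f : X → ℂ} (l : List X)
    (hf : ContDiff ℝ (m + l.length : ℕ) f) : ContDiff ℝ m (pderivList l f) := by
  induction l generalizing m with
  | nil => exact hf
  | cons v l ih =>
    refine contDiff_pderivAlong v (ih ?_)
    convert hf using 2
    simp only [List.length_cons]
    omega

lemma pderivList_append_singleton (l : List X) (v : X) (f : X → ℂ) :
    pderivList (l ++ [v]) f = pderivList l (pderivAlong v f) := by
  simp [pderivList]

lemma pderivAlong_add {f g : X → ℂ} (v : X) (hf : Differentiable ℝ f)
    (hg : Differentiable ℝ g) :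
    pderivAlong v (fun z => f z + g z) = fun z => pderivAlong v f z + pderivAlong v g z := by
  funext z
  simp only [pderivAlong]
  rw [fderiv_fun_add (hf z) (hg z)]
  rfl

lemma pderivAlong_mul {f g : X → ℂ} (v : X) (hf : Differentiable ℝ f)
    (hg : Differentiable ℝ g) :
    pderivAlong v (fun z => f z * g z) =
      fun z => pderivAlong v f z * g z + f z * pderivAlong v g z := by
  funext z
  simp only [pderivAlong]
  rw [fderiv_fun_mul (hf z) (hg z)]
  simp only [_root_.add_apply, _root_.smul_apply, smul_eq_mul]
  ring

lemma pderivList_add {f g : X → ℂ} (l : List X) (hf : ContDiff ℝ l.length f)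
    (hg : ContDiff ℝ l.length g) :
    pderivList l (fun z => f z + g z) = fun z => pderivList l f z + pderivList l g z := by
  induction l with
  | nil => rfl
  | cons v l ih =>
    have hle : (l.length : WithTop ℕ∞) ≤ ((v :: l).length : ℕ) := by simp
    have h1 {h : X → ℂ} (hh : ContDiff ℝ (v :: l).length h) :
        Differentiable ℝ (pderivList l h) :=
      (contDiff_pderivList (m := 1) l (by
        convert hh using 2; simp only [List.length_cons]; omega)).differentiable (by simp)
    change pderivAlong v (pderivList l _) = _
    rw [ih (hf.of_le hle) (hg.of_le hle), pderivAlong_add v (h1 hf) (h1 hg)]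
    rfl

/-- Leibniz bound for iterated directional derivatives of a product. -/
lemma norm_pderivList_mul_le {f g : X → ℂ} (l : List X) {A B : ℝ} (z : X)
    (hf : ContDiff ℝ l.length f) (hg : ContDiff ℝ l.length g)
    (hA : ∀ l', l'.Sublist l → ‖pderivList l' f z‖ ≤ A)
    (hB : ∀ l', l'.Sublist l → ‖pderivList l' g z‖ ≤ B) :
    ‖pderivList l (fun z => f z * g z) z‖ ≤ 2 ^ l.length * (A * B) := by
  induction l using List.reverseRecOn generalizing f g with
  | nil =>
    have h1 := hA [] (List.Sublist.refl _)
    have h2 := hB [] (List.Sublist.refl _)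
    simp only [pderivList, List.foldr_nil, List.length_nil, pow_zero, one_mul, norm_mul] at *
    exact mul_le_mul h1 h2 (norm_nonneg _) ((norm_nonneg _).trans h1)
  | append_singleton l v ih =>
    have hlen : (l ++ [v]).length = l.length + 1 := by simp
    rw [hlen] at hf hg
    have hle : (l.length : WithTop ℕ∞) ≤ (l.length + 1 : ℕ) := by simp
    have hf0 := hf.of_le hle
    have hg0 := hg.of_le hle
    have hf' := contDiff_pderivAlong v hf
    have hg' := contDiff_pderivAlong v hg
    have sub0 {l' : List X} (h : l'.Sublist l) : l'.Sublist (l ++ [v]) :=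
      h.trans (List.sublist_append_left l [v])
    have sub1 {l' : List X} (h : l'.Sublist l) : (l' ++ [v]).Sublist (l ++ [v]) :=
      h.append_right [v]
    have key1 := ih hf' hg0
      (fun l' h => by rw [← pderivList_append_singleton]; exact hA _ (sub1 h))
      (fun l' h => hB _ (sub0 h))
    have key2 := ih hf0 hg' (fun l' h => hA _ (sub0 h))
      (fun l' h => by rw [← pderivList_append_singleton]; exact hB _ (sub1 h))
    rw [pderivList_append_singleton, pderivAlong_mul v (hf.differentiable (by simp))
      (hg.differentiable (by simp)), pderivList_add l (hf'.mul hg0) (hf0.mul hg'), hlen]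
    refine (norm_add_le _ _).trans ?_
    rw [pow_succ]
    linarith

lemma tsupport_pderivList_subset (l : List X) (f : X → ℂ) :
    tsupport (pderivList l f) ⊆ tsupport f := by
  induction l with
  | nil => exact subset_rfl
  | cons v l ih => exact (tsupport_fderiv_apply_subset ℝ v).trans ih

lemma hasCompactSupport_pderivList {f : X → ℂ} (l : List X) (hf : HasCompactSupport f) :
    HasCompactSupport (pderivList l f) :=
  hf.of_isClosed_subset (isClosed_tsupport _) (tsupport_pderivList_subset l f)

lemma pderivList_comp_smul_sub (l : List X) (f : X → ℂ) (c : ℝ) (b : X)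
    (hf : ContDiff ℝ l.length f) :
    pderivList l (fun z => f (c • (z - b))) =
      fun z => (c : ℂ) ^ l.length * pderivList l f (c • (z - b)) := by
  induction l with
  | nil => simp [pderivList]
  | cons v l ih =>
    have hle : (l.length : WithTop ℕ∞) ≤ ((v :: l).length : ℕ) := by simp
    have h1 : Differentiable ℝ (pderivList l f) :=
      (contDiff_pderivList (m := 1) l (by
        convert hf using 2; simp only [List.length_cons]; omega)).differentiable (by simp)
    change pderivAlong v (pderivList l _) = _
    rw [ih (hf.of_le hle)]
    funext z
    have h2 : HasFDerivAt (fun z : X => c • (z - b)) (c • ContinuousLinearMap.id ℝ X) z :=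
      ((hasFDerivAt_id z).sub_const b).const_smul c
    have h3 := ((h1 (c • (z - b))).hasFDerivAt.comp z h2).const_mul ((c : ℂ) ^ l.length)
    have h4 := h3.fderiv
    simp only [Function.comp_def] at h4
    simp only [pderivAlong, pderivList, List.foldr_cons, List.length_cons] at h4 ⊢
    rw [h4]
    simp
    ring

end PartialDerivatives

section Fourier

variable {V : Type*} [NormedAddCommGroup V] [InnerProductSpace ℝ V] [FiniteDimensional ℝ V]
  [MeasurableSpace V] [BorelSpace V]

open scoped FourierTransform

lemma fourier_pderivList {f : V → ℂ} (l : List V) (hf : ContDiff ℝ l.length f)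
    (hc : HasCompactSupport f) (w : V) :
    𝓕 (pderivList l f) w =
      (l.map fun v => 2 * (Real.pi : ℂ) * Complex.I * (⟪v, w⟫ : ℂ)).prod * 𝓕 f w := by
  induction l with
  | nil => simp [pderivList]
  | cons v l ih =>
    have hle : (l.length : WithTop ℕ∞) ≤ ((v :: l).length : ℕ) := by simp
    have h1 : ContDiff ℝ 1 (pderivList l f) :=
      contDiff_pderivList (m := 1) l (by
        convert hf using 2; simp only [List.length_cons]; omega)
    have hc' := hasCompactSupport_pderivList l hc
    have hi := h1.continuous.integrable_of_hasCompactSupport hc' (μ := volume)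
    have hi' := (h1.continuous_fderiv (by simp)).integrable_of_hasCompactSupport
      (hc'.fderiv ℝ) (μ := volume)
    have key := Real.fourier_fderiv hi (h1.differentiable (by simp)) hi'
    have key2 := congrArg (fun L : V →L[ℝ] ℂ => L v) (congrFun key w)
    rw [Real.fourier_continuousLinearMap_apply hi', VectorFourier.fourierSMulRight_apply] at key2
    change 𝓕 (fun x => fderiv ℝ (pderivList l f) x v) w = _
    rw [key2, ih (hf.of_le hle)]
    have h2 : innerSL ℝ w v = ⟪v, w⟫ := real_inner_comm v w
    simp [h2, mul_assoc]

lemma norm_fourier_le_of_closedBall {f : V → ℂ} {M r : ℝ} (c : V) (hM : ∀ z, ‖f z‖ ≤ M)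
    (hf : tsupport f ⊆ Metric.closedBall c r) (w : V) :
    ‖𝓕 f w‖ ≤ M * volume.real (Metric.closedBall c r) := by
  have h0 : ∀ z, z ∉ Metric.closedBall c r → f z = 0 := fun z hz =>
    image_eq_zero_of_notMem_tsupport fun h => hz (hf h)
  rw [Real.fourier_eq, ← setIntegral_eq_integral_of_forall_compl_eq_zero
    (s := Metric.closedBall c r) (fun z hz => by simp [h0 z hz])]
  refine norm_setIntegral_le_of_norm_le_const measure_closedBall_lt_top fun z _ => ?_
  simpa using hM z

end Fourier

section Euclidean

open scoped FourierTransform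

variable {d : ℕ}

lemma norm_fourier_mul_prod_le {f : EuclideanSpace ℝ (Fin d) → ℂ} {M r : ℝ}
    (c : EuclideanSpace ℝ (Fin d)) (hf : ContDiff ℝ (2 * d : ℕ) f)
    (hM : ∀ l : List (Fin d), l.length ≤ 2 * d → ∀ z,
      ‖pderivList (l.map fun i => EuclideanSpace.single i (1 : ℝ)) f z‖ ≤ M)
    (hs : tsupport f ⊆ Metric.closedBall c r) (w : EuclideanSpace ℝ (Fin d)) :
    ‖𝓕 f w‖ * ∏ i, (1 + w i ^ 2) ≤ 2 ^ d * (M * volume.real (Metric.closedBall c r)) := by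
  have key : ∀ S ∈ (Finset.univ : Finset (Fin d)).powerset,
      ‖𝓕 f w‖ * ∏ i ∈ S, w i ^ 2 ≤ M * volume.real (Metric.closedBall c r) := by
    intro S _
    set l : List (Fin d) := S.toList ++ S.toList with hl
    have hlen : l.length ≤ 2 * d := by
      have := S.card_le_univ
      simp only [Fintype.card_fin] at this
      simp only [hl, List.length_append, Finset.length_toList]
      omega
    set L : List (EuclideanSpace ℝ (Fin d)) := l.map fun i => EuclideanSpace.single i (1 : ℝ)
    have hL : ContDiff ℝ L.length f := hf.of_le (by simpa [L] using mod_cast hlen)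
    have hc : HasCompactSupport f :=
      (isCompact_closedBall c r).of_isClosed_subset (isClosed_tsupport _) hs
    refine le_trans ?_ (norm_fourier_le_of_closedBall c (hM l hlen)
      ((tsupport_pderivList_subset L f).trans hs) w)
    rw [fourier_pderivList L hL hc, norm_mul, mul_comm]
    refine mul_le_mul_of_nonneg_right ?_ (norm_nonneg _)
    have h1 : ‖(L.map fun v => 2 * (Real.pi : ℂ) * Complex.I * (⟪v, w⟫ : ℂ)).prod‖ =
        ∏ i ∈ S, (2 * Real.pi * |w i|) ^ 2 := by
      simp only [L, hl, List.map_append, List.map_map, List.prod_append, ← sq,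
        Finset.prod_pow, norm_pow]
      congr 1
      rw [← Finset.prod_map_toList, List.norm_prod, List.map_map]
      congr 2
      funext i
      simp [EuclideanSpace.inner_single_left, abs_of_pos Real.pi_pos]
    rw [h1]
    refine Finset.prod_le_prod (fun i _ => sq_nonneg _) fun i _ => ?_
    rw [mul_pow, sq_abs]
    have : 1 ≤ (2 * Real.pi) ^ 2 := by nlinarith [Real.pi_gt_three]
    nlinarith [sq_nonneg (w i)]
  rw [Finset.prod_one_add, Finset.mul_sum]
  refine (Finset.sum_le_card_nsmul _ _ _ key).trans_eq ?_
  simp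

lemma integral_euclidean_prod (f : Fin d → ℝ → ℝ) :
    ∫ x : EuclideanSpace ℝ (Fin d), ∏ i, f i (x i) = ∏ i, ∫ t, f i t := by
  rw [← integral_fintype_prod_volume_eq_prod]
  exact (PiLp.volume_preserving_ofLp (Fin d)).integral_comp
    (MeasurableEquiv.toLp 2 (Fin d → ℝ)).symm.measurableEmbedding (fun x : Fin d → ℝ => ∏ i, f i (x i))

lemma integrable_euclidean_prod {f : Fin d → ℝ → ℝ} (hf : ∀ i, Integrable (f i)) :
    Integrable fun x : EuclideanSpace ℝ (Fin d) => ∏ i, f i (x i) :=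
  (PiLp.volume_preserving_ofLp (Fin d)).integrable_comp_of_integrable
    (Integrable.fintype_prod (f := f) hf)

lemma integrable_inv_one_add_affine_sq {s : ℝ} (hs : s ≠ 0) (z : ℝ) :
    Integrable fun t : ℝ => (1 + (z + s * t) ^ 2)⁻¹ := by
  have := (integrable_inv_one_add_sq.comp_add_left z).comp_mul_left' hs
  simpa using this

lemma integral_inv_one_add_affine_sq (s z : ℝ) :
    ∫ t : ℝ, (1 + (z + s * t) ^ 2)⁻¹ = |s|⁻¹ * Real.pi := by
  rw [Measure.integral_comp_mul_left (fun t => (1 + (z + t) ^ 2)⁻¹),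
    integral_add_left_eq_self (fun t : ℝ => (1 + t ^ 2)⁻¹), integral_univ_inv_one_add_sq, abs_inv,
    smul_eq_mul]

lemma norm_le_of_coord_le {z : EuclideanSpace ℝ (Fin d)} {r : ℝ} (h : ∀ i, |z i| ≤ r) :
    ‖z‖ ≤ d * r := by
  have hz : z = ∑ i, z i • EuclideanSpace.single i (1 : ℝ) := by
    ext j
    simp [Finset.sum_apply, Pi.single_apply]
  rw [hz]
  refine (norm_sum_le _ _).trans ((Finset.sum_le_card_nsmul _ _ r fun i _ => ?_).trans_eq ?_)
  · simpa [norm_smul] using h i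
  · simp

lemma contDiff_cutoffProd {χ : ℝ → ℝ} (hχ : ContDiff ℝ (⊤ : ℕ∞) χ) :
    ContDiff ℝ (⊤ : ℕ∞) (cutoffProd d χ) := by
  unfold cutoffProd
  fun_prop

lemma tsupport_cutoff_subset {χ : ℝ → ℝ} (hχ0 : ∀ z : ℝ, 1 ≤ |z| → χ z = 0) {r : ℝ} (hr : 0 < r)
    (b : EuclideanSpace ℝ (Fin d)) :
    tsupport (fun y => (cutoffProd d χ (r⁻¹ • (y - b)) : ℂ)) ⊆ Metric.closedBall b (d * r) := by
  refine closure_minimal (fun y hy => ?_) Metric.isClosed_closedBall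
  rw [mem_closedBall_iff_norm]
  refine norm_le_of_coord_le fun i => ?_
  by_contra! hi
  refine hy ?_
  simp only [Complex.ofReal_eq_zero]
  refine Finset.prod_eq_zero (Finset.mem_univ i) (hχ0 _ ?_)
  simp only [PiLp.smul_apply, smul_eq_mul, abs_mul, abs_inv, abs_of_pos hr]
  rw [inv_mul_eq_div, one_le_div hr]
  exact hi.le

/-- Derivatives of the rescaled cutoff are bounded uniformly in the scale `r ≥ 1`. -/
lemma exists_cutoff_bound {χ : ℝ → ℝ} (hχ : ContDiff ℝ (⊤ : ℕ∞) χ)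
    (hχ0 : ∀ z : ℝ, 1 ≤ |z| → χ z = 0) (n : ℕ) :
    ∃ B : ℝ, 0 < B ∧ ∀ l : List (Fin d), l.length ≤ n → ∀ r : ℝ, 1 ≤ r →
      ∀ b y : EuclideanSpace ℝ (Fin d),
      ‖pderivList (l.map fun i => EuclideanSpace.single i (1 : ℝ))
        (fun y => (cutoffProd d χ (r⁻¹ • (y - b)) : ℂ)) y‖ ≤ B := by
  set G : EuclideanSpace ℝ (Fin d) → ℂ := fun z => (cutoffProd d χ z : ℂ) with hG
  have hGs : ContDiff ℝ (⊤ : ℕ∞) G := Complex.ofRealCLM.contDiff.comp (contDiff_cutoffProd hχ)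
  have hGn (m : ℕ) : ContDiff ℝ m G := hGs.of_le (mod_cast le_top)
  have hGc : HasCompactSupport G := by
    refine (isCompact_closedBall 0 (d * 1 : ℝ)).of_isClosed_subset (isClosed_tsupport _) ?_
    simpa [hG] using tsupport_cutoff_subset (d := d) hχ0 one_pos 0
  have h1 (l : List (Fin d)) : ∃ B : ℝ, ∀ y,
      ‖pderivList (l.map fun i => EuclideanSpace.single i (1 : ℝ)) G y‖ ≤ B :=
    (hasCompactSupport_pderivList _ hGc).exists_bound_of_continuous
      (contDiff_pderivList (m := 0) _ (hGn _)).continuous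
  choose B hB using h1
  obtain ⟨C, hC⟩ := ((List.finite_length_le (Fin d) n).image B).bddAbove
  refine ⟨max C 1, by positivity, fun l hl r hr b y => ?_⟩
  rw [pderivList_comp_smul_sub _ G r⁻¹ b (hGn _), norm_mul]
  have h2 : ‖((r⁻¹ : ℝ) : ℂ) ^ (l.map fun i => EuclideanSpace.single i (1 : ℝ)).length‖ ≤ 1 := by
    rw [norm_pow, Complex.norm_real, Real.norm_of_nonneg (by positivity)]
    exact pow_le_one₀ (by positivity) (inv_le_one_of_one_le₀ hr)
  calc _ ≤ 1 * B l := mul_le_mul h2 (hB l _) (norm_nonneg _) zero_le_one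
    _ ≤ max C 1 := by rw [one_mul]; exact (hC ⟨l, hl, rfl⟩).trans (le_max_left _ _)

end Euclidean

section OscillatoryIntegral

open scoped FourierTransform

variable {d : ℕ}

/-- Decay of the Fourier transform of a localised amplitude, uniformly in the scale `r ≥ 1`. -/
lemma exists_fourier_cutoff_bound {χ : ℝ → ℝ} (hχ : ContDiff ℝ (⊤ : ℕ∞) χ)
    (hχ0 : ∀ z : ℝ, 1 ≤ |z| → χ z = 0) :
    ∃ Q : ℝ, 0 < Q ∧ ∀ (φ : EuclideanSpace ℝ (Fin d) → ℂ) (D : ℝ), 0 ≤ D →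
      ContDiff ℝ (2 * d : ℕ) φ →
      (∀ l : List (Fin d), l.length ≤ 2 * d → ∀ z,
        ‖pderivList (l.map fun i => EuclideanSpace.single i (1 : ℝ)) φ z‖ ≤ D) →
      ∀ r : ℝ, 1 ≤ r → ∀ b w : EuclideanSpace ℝ (Fin d),
        ‖𝓕 (fun y => (cutoffProd d χ (r⁻¹ • (y - b)) : ℂ) * φ y) w‖ ≤
          Q * D * r ^ d * ∏ i, (1 + w i ^ 2)⁻¹ := by
  obtain ⟨B, hB0, hB⟩ := exists_cutoff_bound (d := d) hχ hχ0 (2 * d)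
  set v := volume.real (Metric.ball (0 : EuclideanSpace ℝ (Fin d)) 1)
  have hv : 0 ≤ v := measureReal_nonneg
  refine ⟨2 ^ d * (2 ^ (2 * d) * B * (d ^ d * v)) + 1, by positivity, ?_⟩
  intro φ D hD hφ hφD r hr b w
  have hr0 : 0 < r := by linarith
  set g : EuclideanSpace ℝ (Fin d) → ℂ := fun y => (cutoffProd d χ (r⁻¹ • (y - b)) : ℂ) with hg
  have hgs : ContDiff ℝ (⊤ : ℕ∞) g :=
    Complex.ofRealCLM.contDiff.comp ((contDiff_cutoffProd hχ).comp (by fun_prop))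
  have hgn (m : ℕ) : ContDiff ℝ m g := hgs.of_le (mod_cast le_top)
  have hP : 0 < ∏ i, (1 + w i ^ 2) := Finset.prod_pos fun i _ => by positivity
  have h1 : ∀ l : List (Fin d), l.length ≤ 2 * d → ∀ z,
      ‖pderivList (l.map fun i => EuclideanSpace.single i (1 : ℝ)) (fun y => g y * φ y) z‖ ≤
        2 ^ (2 * d) * (B * D) := by
    intro l hl z
    refine (norm_pderivList_mul_le (A := B) (B := D) _ z (hgn _)
      (hφ.of_le (by simpa using mod_cast hl)) ?_ ?_).trans ?_
    · intro l' hl'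
      obtain ⟨m, hm, rfl⟩ := List.sublist_map_iff.1 hl'
      exact hB m (hm.length_le.trans hl) r hr b z
    · intro l' hl'
      obtain ⟨m, hm, rfl⟩ := List.sublist_map_iff.1 hl'
      exact hφD m (hm.length_le.trans hl) z
    · rw [List.length_map]
      gcongr
      norm_num
  have h2 := norm_fourier_mul_prod_le b ((hgn _).mul hφ) h1
    ((tsupport_mul_subset_left).trans (tsupport_cutoff_subset hχ0 hr0 b)) w
  rw [Measure.addHaar_real_closedBall _ _ (by positivity), finrank_euclideanSpace_fin] at h2
  rw [Finset.prod_inv_distrib, ← div_eq_mul_inv, le_div_iff₀ hP]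
  refine h2.trans ?_
  have h3 : 0 ≤ D * r ^ d := by positivity
  rw [mul_pow]
  calc _ = 2 ^ d * (2 ^ (2 * d) * B * (d ^ d * v)) * (D * r ^ d) := by ring
    _ ≤ _ := by nlinarith

lemma norm_efun (t : ℝ) : ‖efun t‖ = 1 := by
  have : efun t = Complex.exp ((2 * Real.pi * t : ℝ) * Complex.I) := by
    unfold efun
    congr 1
    push_cast
    ring
  rw [this, Complex.norm_exp_ofReal_mul_I]

lemma efun_add (s t : ℝ) : efun (s + t) = efun s * efun t := by
  unfold efun
  rw [← Complex.exp_add]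
  congr 1
  push_cast
  ring

lemma continuous_efun : Continuous efun := by
  unfold efun
  fun_prop

lemma integral_mul_efun_inner (f : EuclideanSpace ℝ (Fin d) → ℂ) (w : EuclideanSpace ℝ (Fin d)) :
    ∫ y, f y * efun ⟪w, y⟫ = 𝓕 f (-w) := by
  rw [Real.fourier_eq']
  congr 1
  funext y
  rw [smul_eq_mul, mul_comm, efun, inner_neg_right, real_inner_comm]
  congr 2
  push_cast
  ring

/-- Pointwise in `s`, the oscillatory integral is bounded by an integrable weight. -/
lemma exists_oscillatory_bound (hd : 2 ≤ d) {χ : ℝ → ℝ} (hχ : ContDiff ℝ (⊤ : ℕ∞) χ)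
    (hχ0 : ∀ z : ℝ, 1 ≤ |z| → χ z = 0) :
    ∃ K : ℝ, 0 < K ∧
      ∀ (φ : EuclideanSpace ℝ (Fin d) → EuclideanSpace ℝ (Fin d) → ℂ) (D : ℝ), 0 ≤ D →
      ContDiff ℝ (2 * d : ℕ)
        (fun p : EuclideanSpace ℝ (Fin d) × EuclideanSpace ℝ (Fin d) => φ p.1 p.2) →
      (∀ l : List (Fin d), l.length ≤ 2 * d → ∀ x y,
        ‖pderivList (l.map fun i => EuclideanSpace.single i (1 : ℝ)) (φ x) y‖ ≤ D) →
      ∀ r : ℝ, 1 ≤ r → ∀ (ξ ζ a b : EuclideanSpace ℝ (Fin d)) (s : ℝ),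
        ‖∫ p : EuclideanSpace ℝ (Fin d) × EuclideanSpace ℝ (Fin d),
              ((cutoffProd d χ (r⁻¹ • (p.1 - a)) *
                  cutoffProd d χ (r⁻¹ • (p.2 - b)) : ℝ) : ℂ) *
                φ p.1 p.2 * efun (⟪ξ, p.1⟫ + ⟪ζ, p.2⟫ + s * ⟪p.1, p.2⟫)‖ ≤
          K * D * r ^ (2 * d) * (1 + s ^ 2)⁻¹ := by
  obtain ⟨Q, hQ0, hQ⟩ := exists_fourier_cutoff_bound (d := d) hχ hχ0
  obtain ⟨B, hB0, hB⟩ := exists_cutoff_bound (d := d) hχ hχ0 0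
  set v := volume.real (Metric.ball (0 : EuclideanSpace ℝ (Fin d)) 1)
  have hv : 0 ≤ v := measureReal_nonneg
  have hpi := Real.pi_pos
  refine ⟨2 * (B * Q * (d ^ d * v + Real.pi ^ d)), by positivity, ?_⟩
  intro φ D hD hφ hφD r hr ξ ζ a b s
  have hr0 : 0 < r := by linarith
  set g : EuclideanSpace ℝ (Fin d) → EuclideanSpace ℝ (Fin d) → ℂ :=
    fun c y => (cutoffProd d χ (r⁻¹ • (y - c)) : ℂ) with hg
  have hgc (c) : Continuous (g c) :=
    Complex.continuous_ofReal.comp ((contDiff_cutoffProd hχ).continuous.comp (by fun_prop))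
  have hgB (c x) : ‖g c x‖ ≤ B := hB [] le_rfl r hr c x
  have hg0 (c x) (hx : x ∉ Metric.closedBall c (d * r)) : g c x = 0 :=
    image_eq_zero_of_notMem_tsupport fun h => hx (tsupport_cutoff_subset hχ0 hr0 c h)
  set F : EuclideanSpace ℝ (Fin d) × EuclideanSpace ℝ (Fin d) → ℂ := fun p =>
    (g a p.1 * g b p.2) * φ p.1 p.2 * efun (⟪ξ, p.1⟫ + ⟪ζ, p.2⟫ + s * ⟪p.1, p.2⟫) with hF
  have hFi : Integrable F := by
    refine Continuous.integrable_of_hasCompactSupport ?_ ?_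
    · have h1 := (hgc a).comp (continuous_fst (Y := EuclideanSpace ℝ (Fin d)))
      have h2 := (hgc b).comp (continuous_snd (X := EuclideanSpace ℝ (Fin d)))
      refine ((h1.mul h2).mul hφ.continuous).mul (continuous_efun.comp ?_)
      fun_prop
    · refine HasCompactSupport.intro
        ((isCompact_closedBall a (d * r)).prod (isCompact_closedBall b (d * r))) ?_
      intro p hp
      rw [Set.mem_prod, not_and_or] at hp
      rcases hp with hp | hp
      · simp [hF, hg0 a _ hp]
      · simp [hF, hg0 b _ hp]
  have hIF : (∫ p : EuclideanSpace ℝ (Fin d) × EuclideanSpace ℝ (Fin d),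
      ((cutoffProd d χ (r⁻¹ • (p.1 - a)) * cutoffProd d χ (r⁻¹ • (p.2 - b)) : ℝ) : ℂ) *
        φ p.1 p.2 * efun (⟪ξ, p.1⟫ + ⟪ζ, p.2⟫ + s * ⟪p.1, p.2⟫)) =
      ∫ x, g a x * efun ⟪ξ, x⟫ * 𝓕 (fun y => g b y * φ x y) (-(ζ + s • x)) := by
    have h1 : (∫ p : EuclideanSpace ℝ (Fin d) × EuclideanSpace ℝ (Fin d),
      ((cutoffProd d χ (r⁻¹ • (p.1 - a)) * cutoffProd d χ (r⁻¹ • (p.2 - b)) : ℝ) : ℂ) *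
        φ p.1 p.2 * efun (⟪ξ, p.1⟫ + ⟪ζ, p.2⟫ + s * ⟪p.1, p.2⟫)) = ∫ p, F p := by
      simp only [hF, hg, Complex.ofReal_mul]
    rw [h1, Measure.volume_eq_prod, integral_prod _ (by rwa [← Measure.volume_eq_prod])]
    congr 1
    funext x
    rw [← integral_mul_efun_inner, ← integral_const_mul]
    congr 1
    funext y
    simp only [hF]
    rw [add_assoc, efun_add, inner_add_left, real_inner_smul_left]
    ring
  rw [hIF]
  have hbound (x) : ‖g a x * efun ⟪ξ, x⟫ * 𝓕 (fun y => g b y * φ x y) (-(ζ + s • x))‖ ≤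
      B * (Q * D * r ^ d) * ∏ i, (1 + (ζ i + s * x i) ^ 2)⁻¹ := by
    rw [norm_mul, norm_mul, norm_efun, mul_one, mul_assoc]
    refine mul_le_mul (hgB a x) ?_ (norm_nonneg _) hB0.le
    have := hQ (φ x) D hD (hφ.comp (contDiff_const.prodMk contDiff_id)) (fun l hl z => hφD l hl x z)
      r hr b (-(ζ + s • x))
    refine this.trans_eq ?_
    congr 1
    refine Finset.prod_congr rfl fun i _ => ?_
    simp only [PiLp.neg_apply, PiLp.add_apply, PiLp.smul_apply, smul_eq_mul, neg_sq]
  have hA : 0 ≤ B * Q * D * r ^ (2 * d) := by positivity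
  have hpow : r ^ (2 * d) = r ^ d * r ^ d := by rw [two_mul, pow_add]
  rw [← div_eq_mul_inv, le_div_iff₀ (by positivity)]
  rcases le_total |s| 1 with hs | hs
  · have h1 : ‖∫ x, g a x * efun ⟪ξ, x⟫ * 𝓕 (fun y => g b y * φ x y) (-(ζ + s • x))‖ ≤
        B * (Q * D * r ^ d) * volume.real (Metric.closedBall a (d * r)) := by
      rw [← setIntegral_eq_integral_of_forall_compl_eq_zero
        (s := Metric.closedBall a (d * r)) (fun z hz => by simp [hg0 a z hz])]
      refine norm_setIntegral_le_of_norm_le_const measure_closedBall_lt_top fun z _ => ?_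
      refine (hbound z).trans (mul_le_of_le_one_right (by positivity) ?_)
      refine Finset.prod_le_one (fun i _ => by positivity) fun i _ => ?_
      exact inv_le_one_of_one_le₀ (by nlinarith [sq_nonneg (ζ i + s * z i)])
    rw [Measure.addHaar_real_closedBall _ _ (by positivity), finrank_euclideanSpace_fin,
      mul_pow] at h1
    have h2 : s ^ 2 ≤ 1 := by rw [← sq_abs]; exact pow_le_one₀ (abs_nonneg _) hs
    calc _ ≤ (B * (Q * D * r ^ d) * (d ^ d * r ^ d * v)) * 2 :=
          mul_le_mul h1 (by linarith) (by positivity) (by positivity)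
      _ = 2 * (B * Q * D * r ^ (2 * d) * (d ^ d * v)) := by rw [hpow]; ring
      _ ≤ 2 * (B * Q * D * r ^ (2 * d) * (d ^ d * v + Real.pi ^ d)) := by
          gcongr
          exact le_add_of_nonneg_right (by positivity)
      _ = _ := by ring
  · have hs0 : s ≠ 0 := by
      rintro rfl
      norm_num at hs
    have h1 := norm_integral_le_of_norm_le
      ((integrable_euclidean_prod fun i => integrable_inv_one_add_affine_sq hs0 (ζ i)).const_mul
        (B * (Q * D * r ^ d))) (Filter.Eventually.of_forall hbound)
    rw [integral_const_mul,
      integral_euclidean_prod (fun i t => (1 + (ζ i + s * t) ^ 2)⁻¹)] at h1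
    simp only [integral_inv_one_add_affine_sq, Finset.prod_const, Finset.card_univ,
      Fintype.card_fin, mul_pow] at h1
    have h2 : |s|⁻¹ ^ d * (1 + s ^ 2) ≤ 2 := by
      have h3 : |s|⁻¹ ^ d ≤ |s|⁻¹ ^ 2 :=
        pow_le_pow_of_le_one (by positivity) (inv_le_one_of_one_le₀ hs) hd
      have h4 : 1 ≤ |s| ^ 2 := one_le_pow₀ hs
      calc |s|⁻¹ ^ d * (1 + s ^ 2) ≤ |s|⁻¹ ^ 2 * (|s| ^ 2 + |s| ^ 2) := by
            rw [sq_abs] at h4 ⊢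
            gcongr
        _ = 2 := by
            have : |s| ≠ 0 := abs_ne_zero.2 hs0
            field_simp
            norm_num
    calc _ ≤ (B * (Q * D * r ^ d) * (|s|⁻¹ ^ d * Real.pi ^ d)) * (1 + s ^ 2) :=
          mul_le_mul_of_nonneg_right h1 (by positivity)
      _ = B * (Q * D * r ^ d) * Real.pi ^ d * (|s|⁻¹ ^ d * (1 + s ^ 2)) := by ring
      _ ≤ B * (Q * D * (r ^ d * r ^ d)) * Real.pi ^ d * 2 := by
          gcongr
          exact le_mul_of_one_le_left (by positivity) (one_le_pow₀ hr)
      _ = 2 * (B * Q * D * r ^ (2 * d) * Real.pi ^ d) := by rw [hpow]; ring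
      _ ≤ 2 * (B * Q * D * r ^ (2 * d) * (d ^ d * v + Real.pi ^ d)) := by
          gcongr
          exact le_add_of_nonneg_left (by positivity)
      _ = _ := by ring

end OscillatoryIntegral

theorem statement12 (d : ℕ) (hd : 3 ≤ d) (χ₀ : ℝ → ℝ)
    (hχs : ContDiff ℝ (⊤ : ℕ∞) χ₀)
    (hχ1 : ∀ z : ℝ, |z| ≤ 1 / 2 → χ₀ z = 1)
    (hχ0 : ∀ z : ℝ, 1 ≤ |z| → χ₀ z = 0) :
    ∃ C : ℝ, 0 < C ∧
    ∀ D : ℝ, 0 < D →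
    ∀ Φ : ℝ → EuclideanSpace ℝ (Fin d) → EuclideanSpace ℝ (Fin d) → ℂ,
      (∀ s : ℝ, ContDiff ℝ (20 * d : ℕ)
        (fun p : EuclideanSpace ℝ (Fin d) × EuclideanSpace ℝ (Fin d) => Φ s p.1 p.2)) →
      PhiDerivBound d D Φ →
    ∀ lam : ℝ, 1 ≤ lam →
    ∀ ξ ζ a b : EuclideanSpace ℝ (Fin d),
      (∫⁻ s : ℝ,
          (‖∫ p : EuclideanSpace ℝ (Fin d) × EuclideanSpace ℝ (Fin d),
              ((cutoffProd d χ₀ (lam⁻¹ • (p.1 - a)) *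
                  cutoffProd d χ₀ (lam⁻¹ • (p.2 - b)) : ℝ) : ℂ) *
                Φ s p.1 p.2 *
                efun (⟪ξ, p.1⟫ + ⟪ζ, p.2⟫ + s * ⟪p.1, p.2⟫)‖₊ : ℝ≥0∞))
        ≤ ENNReal.ofReal (C * D * lam ^ (2 * (d : ℝ))) := by
  obtain ⟨K, hK0, hK⟩ := exists_oscillatory_bound (d := d) (by omega) hχs hχ0
  have hpi := Real.pi_pos
  refine ⟨K * Real.pi, by positivity, ?_⟩
  intro D hD Φ hΦ hΦD lam hlam ξ ζ a b
  have hlam0 : 0 < lam := by linarith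
  have hpt (s : ℝ) := hK (Φ s) D hD.le ((hΦ s).of_le (mod_cast by omega))
    (fun l hl x y => hΦD [] l (by simp) (by omega) s x y) lam hlam ξ ζ a b s
  have hint : Integrable fun s : ℝ => K * D * lam ^ (2 * d) * (1 + s ^ 2)⁻¹ :=
    integrable_inv_one_add_sq.const_mul _
  calc _ ≤ ∫⁻ s : ℝ, ENNReal.ofReal (K * D * lam ^ (2 * d) * (1 + s ^ 2)⁻¹) := by
        refine lintegral_mono fun s => ?_
        rw [← enorm_eq_nnnorm, ← ofReal_norm]
        exact ENNReal.ofReal_le_ofReal (hpt s)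
    _ = ENNReal.ofReal (∫ s : ℝ, K * D * lam ^ (2 * d) * (1 + s ^ 2)⁻¹) :=
        (ofReal_integral_eq_lintegral_ofReal hint
          (Filter.Eventually.of_forall fun s => by positivity)).symm
    _ = _ := by
        rw [integral_const_mul, integral_univ_inv_one_add_sq]
        congr 1
        have : lam ^ (2 * (d : ℝ)) = lam ^ (2 * d) := by
          rw [← Real.rpow_natCast]
          push_cast
          rfl
        rw [this]
        ring
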